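/- Let u be the non-simple Parry word associated with the substitution φ and let h′ = min{ℓ : m ≤ ℓ ≤ m+p−1, α_ℓ ≥ 1}. Let 0t0 be a factor of u with |t|_0 = 0. Then: (i) if t is empty, 00 is a prefix of u; (ii) if t is nonempty and its last letter ℓ satisfies ℓ < m or ℓ > h′, then 0t0 is a suffix of φ^ℓ(0)·0 and φ^ℓ(0)·0 is a factor of u; (iii) if t is nonempty and its last letter ℓ satisfies m ≤ ℓ ≤ h′, then either 0t0 is a suffix of φ^ℓ(0)·0 and φ^ℓ(0)·0 is a factor of u, or 0t0 is a suffix of φ^{ℓ+p}(0)·0 and φ^{ℓ+p}(0)·0 is a factor of u. -/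

import Mathlib

/-- The prefix of length `n` of the infinite word `u`. -/
def pref (u : ℕ → ℕ) (n : ℕ) : List ℕ := (List.range n).map u

/-- `w` is a factor of the infinite word `u`. -/
def IsFactor (u : ℕ → ℕ) (w : List ℕ) : Prop :=
  ∃ i : ℕ, w = (List.range w.length).map (fun j => u (i + j))

/-- The Parikh vector of `w`, viewed as a word over `{0, …, m-1}`. -/
def parikh (m : ℕ) (w : List ℕ) : Fin m → ℤ := fun ℓ => (w.count (ℓ : ℕ) : ℤ)

/-- The set of relative Parikh vectors of factors of `u` of length `n`. -/
def relParikhSet (m : ℕ) (u : ℕ → ℕ) (n : ℕ) : Set (Fin m → ℤ) :=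
  { v | ∃ w : List ℕ, IsFactor u w ∧ w.length = n ∧ v = parikh m w - parikh m (pref u n) }

/-- The extension of a substitution `φ` to finite words. -/
def substW (φ : ℕ → List ℕ) (w : List ℕ) : List ℕ := w.flatMap φ

/-- The `k`-th iterate of the substitution `φ`, applied to the word `w`. -/
def iterW (φ : ℕ → List ℕ) (k : ℕ) (w : List ℕ) : List ℕ := (substW φ)^[k] w

/-- The substitution `ℓ ↦ 0^{α ℓ} (σ ℓ)`. -/
def blockSubst (α σ : ℕ → ℕ) (ℓ : ℕ) : List ℕ := List.replicate (α ℓ) 0 ++ [σ ℓ]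

/-- The map on letters sending each letter `ℓ` to the last letter of its image. -/
def parrySucc (m p ℓ : ℕ) : ℕ := if ℓ = m + p - 1 then m else ℓ + 1

theorem pref_add (u : ℕ → ℕ) (a b : ℕ) :
    pref u (a + b) = pref u a ++ (List.range b).map (fun j => u (a + j)) := by
  simp [pref, List.range_add, Function.comp_def]

theorem length_pref (u : ℕ → ℕ) (n : ℕ) : (pref u n).length = n := by simp [pref]

theorem isFactor_of_append_prefix_pref {u : ℕ → ℕ} {v w : List ℕ} {n : ℕ}
    (h : v ++ w <+: pref u n) : IsFactor u w := by
  refine ⟨v.length, ?_⟩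
  have hle : v.length + w.length ≤ n := by
    simpa [length_pref] using h.length_le
  obtain ⟨c, rfl⟩ := Nat.exists_eq_add_of_le hle
  have h2 : pref u (v.length + w.length) <+: pref u (v.length + w.length + c) := by
    rw [pref_add u (v.length + w.length) c]
    exact List.prefix_append _ _
  have h3 : v ++ w = pref u (v.length + w.length) :=
    (List.prefix_of_prefix_length_le h h2 (by simp [length_pref])).eq_of_length
      (by simp [length_pref])
  rw [pref_add] at h3
  exact (List.append_inj h3 (by simp [length_pref])).2

section Iterates

variable (φ : ℕ → List ℕ)

theorem substW_append (v w : List ℕ) : substW φ (v ++ w) = substW φ v ++ substW φ w := by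
  simp [substW]

theorem iterW_zero (w : List ℕ) : iterW φ 0 w = w := rfl

theorem iterW_succ (k : ℕ) (w : List ℕ) : iterW φ (k + 1) w = iterW φ k (substW φ w) := rfl

theorem iterW_succ' (k : ℕ) (w : List ℕ) : iterW φ (k + 1) w = substW φ (iterW φ k w) :=
  Function.iterate_succ_apply' _ _ _

theorem iterW_add (a b : ℕ) (w : List ℕ) : iterW φ (a + b) w = iterW φ a (iterW φ b w) :=
  Function.iterate_add_apply _ _ _ _

theorem iterW_append (k : ℕ) (v w : List ℕ) :
    iterW φ k (v ++ w) = iterW φ k v ++ iterW φ k w := by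
  induction k generalizing v w with
  | zero => rfl
  | succ k ih => simp [iterW_succ, substW_append, ih]

end Iterates

/-- If `0t` is a suffix of `WZ`, the word `t` has no `0` and `Z` has one, then `0t` is a suffix
of `Z`. -/
theorem zero_cons_suffix_of_append {t W Z : List ℕ} (ht : 0 ∉ t)
    (h : (0 :: t) <:+ W ++ Z) (hZ : 0 ∈ Z) : (0 :: t) <:+ Z := by
  rcases List.suffix_or_suffix_of_suffix h (List.suffix_append W Z) with h1 | h1
  · exact h1
  · rcases List.suffix_cons_iff.1 h1 with h2 | h2
    · exact h2 ▸ List.suffix_refl _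
    · exact absurd (h2.subset hZ) ht

section BlockSubst

variable {α σ : ℕ → ℕ}

theorem substW_blockSubst_cons (x : ℕ) (w : List ℕ) :
    substW (blockSubst α σ) (x :: w) =
      List.replicate (α x) 0 ++ σ x :: substW (blockSubst α σ) w := by
  simp [substW, blockSubst]

theorem exists_iterW_singleton_eq_append (a b x : ℕ) :
    ∃ W, iterW (blockSubst α σ) (a + b) [x] = W ++ iterW (blockSubst α σ) b [σ^[a] x] := by
  induction a generalizing x with
  | zero => exact ⟨[], by simp⟩
  | succ a ih =>
    obtain ⟨W, hW⟩ := ih (σ x)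
    refine ⟨iterW (blockSubst α σ) (a + b) (List.replicate (α x) 0) ++ W, ?_⟩
    rw [show a + 1 + b = a + b + 1 by omega, iterW_succ, substW_blockSubst_cons,
      iterW_append, show substW (blockSubst α σ) [] = [] from rfl, hW]
    simp

theorem exists_iterW_eq_zero_cons_of_cons (hα0 : 1 ≤ α 0) (k : ℕ) (w : List ℕ) :
    ∃ w', iterW (blockSubst α σ) k (0 :: w) = 0 :: w' := by
  induction k with
  | zero => exact ⟨w, rfl⟩
  | succ k ih =>
    obtain ⟨w', hw⟩ := ih
    obtain ⟨a, ha⟩ := Nat.exists_eq_add_of_le' hα0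
    rw [iterW_succ', hw, substW_blockSubst_cons, ha]
    exact ⟨_, rfl⟩

theorem exists_iterW_singleton_eq_zero_cons (hα0 : 1 ≤ α 0) {i k x : ℕ} (hik : i < k)
    (hi : 1 ≤ α (σ^[i] x)) : ∃ w', iterW (blockSubst α σ) k [x] = 0 :: w' := by
  induction i generalizing k x with
  | zero =>
    obtain ⟨k, rfl⟩ := Nat.exists_eq_add_of_le' (Nat.one_le_of_lt hik)
    obtain ⟨a, ha⟩ := Nat.exists_eq_add_of_le' hi
    rw [Function.iterate_zero_apply] at ha
    rw [iterW_succ, substW_blockSubst_cons, ha]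
    exact exists_iterW_eq_zero_cons_of_cons hα0 _ _
  | succ i ih =>
    obtain ⟨k, rfl⟩ := Nat.exists_eq_add_of_le' (Nat.one_le_of_lt hik)
    rw [iterW_succ, substW_blockSubst_cons]
    rcases Nat.eq_zero_or_pos (α x) with h0 | h0
    · rw [h0]
      exact ih (by omega) hi
    · obtain ⟨a, ha⟩ := Nat.exists_eq_add_of_le' (show 1 ≤ α x from h0)
      rw [ha]
      exact exists_iterW_eq_zero_cons_of_cons hα0 _ _

theorem iterW_prefix_succ (hα0 : 1 ≤ α 0) (k : ℕ) :
    iterW (blockSubst α σ) k [0] <+: iterW (blockSubst α σ) (k + 1) [0] := by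
  obtain ⟨a, ha⟩ := Nat.exists_eq_add_of_le' hα0
  have h : substW (blockSubst α σ) [0] = [0] ++ (List.replicate a 0 ++ [σ 0]) := by
    simp [substW, blockSubst, ha, List.replicate_succ]
  rw [iterW_succ, h, iterW_append]
  exact List.prefix_append _ _

theorem length_add_count_zero_le_length_substW (hα0 : 1 ≤ α 0) (w : List ℕ) :
    w.length + w.count 0 ≤ (substW (blockSubst α σ) w).length := by
  induction w with
  | nil => simp
  | cons x w ih =>
    rw [substW_blockSubst_cons]
    by_cases hx : x = 0
    · subst hx
      simp
      omega
    · simp [hx]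
      omega

theorem lt_length_iterW (hα0 : 1 ≤ α 0) (k : ℕ) :
    k < (iterW (blockSubst α σ) k [0]).length := by
  induction k with
  | zero => simp [iterW_zero]
  | succ k ih =>
    obtain ⟨w', hw⟩ := exists_iterW_eq_zero_cons_of_cons (σ := σ) hα0 k []
    have := length_add_count_zero_le_length_substW (σ := σ) hα0 (iterW (blockSubst α σ) k [0])
    rw [iterW_succ']
    rw [hw] at this ih ⊢
    simp at this ih
    omega

/-- A prefix of `φ(w)` that is followed by `y` and ends with a nonzero letter is the image of a
prefix of `w`, and `y` is the first letter of the image of the following letter. -/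
theorem exists_desubst {v w : List ℕ} {x y : ℕ} (hx : x ≠ 0)
    (h : v ++ [x, y] <+: substW (blockSubst α σ) w) :
    ∃ v' x' y', v' ++ [x', y'] <+: w ∧ v ++ [x] = substW (blockSubst α σ) (v' ++ [x']) ∧
      ∃ r, substW (blockSubst α σ) [y'] = y :: r := by
  induction w generalizing v with
  | nil => simp [substW] at h
  | cons z w ih =>
    have hz : substW (blockSubst α σ) (z :: w) =
        (List.replicate (α z) 0 ++ [σ z]) ++ substW (blockSubst α σ) w := by
      simp [substW_blockSubst_cons]
    have hz1 : substW (blockSubst α σ) [z] = List.replicate (α z) 0 ++ [σ z] := by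
      simp [substW, blockSubst]
    rw [hz] at h
    rcases lt_trichotomy v.length (α z) with hv | hv | hv
    · have := h.getElem (i := v.length) (by simp)
      simp [hv] at this
      exact absurd this hx
    · have h1 : v ++ [x] = List.replicate (α z) 0 ++ [σ z] := by
        have h2 : v ++ [x] <+: (List.replicate (α z) 0 ++ [σ z]) ++ substW (blockSubst α σ) w :=
          List.IsPrefix.trans ⟨[y], by simp⟩ h
        exact (List.prefix_of_prefix_length_le h2 (List.prefix_append _ _)
          (by simp [hv])).eq_of_length (by simp [hv])
      rw [← h1, show v ++ [x, y] = (v ++ [x]) ++ [y] by simp,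
        List.prefix_append_right_inj] at h
      cases w with
      | nil => simp [substW] at h
      | cons y' w =>
        refine ⟨[], z, y', ⟨w, by simp⟩, by simp [h1, hz1], ?_⟩
        rw [substW_blockSubst_cons] at h ⊢
        cases ha : α y' with
        | zero =>
          rw [ha] at h
          obtain ⟨r, hr⟩ := h
          simp at hr
          exact ⟨[], by simp [hr.1, substW]⟩
        | succ a =>
          rw [ha] at h
          obtain ⟨r, hr⟩ := h
          simp [List.replicate_succ] at hr
          exact ⟨_, by rw [hr.1, List.replicate_succ]; rfl⟩
    · obtain ⟨v₁, rfl⟩ : ∃ v₁, v = (List.replicate (α z) 0 ++ [σ z]) ++ v₁ := by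
        have h2 : v <+: (List.replicate (α z) 0 ++ [σ z]) ++ substW (blockSubst α σ) w :=
          (List.prefix_append _ _).trans h
        obtain ⟨c, hc⟩ := List.prefix_of_prefix_length_le (List.prefix_append _ _) h2
          (by simp; omega)
        exact ⟨c, hc.symm⟩
      rw [List.append_assoc, List.prefix_append_right_inj] at h
      obtain ⟨v', x', y', h1, h2, h3⟩ := ih h
      refine ⟨z :: v', x', y', by simpa using h1, ?_, h3⟩
      rw [List.append_assoc, h2, ← hz1, ← substW_append]
      rfl

/-- Every occurrence of a nonzero letter in an iterate is the end of some `φ^k(0)`, where this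
`0` is again an occurrence in an iterate. -/
theorem exists_ancestor {n : ℕ} {v : List ℕ} {x y : ℕ} (hx : x ≠ 0)
    (h : v ++ [x, y] <+: iterW (blockSubst α σ) n [0]) :
    ∃ n' k v' y', 1 ≤ k ∧ v' ++ [0, y'] <+: iterW (blockSubst α σ) n' [0] ∧
      v ++ [x] = iterW (blockSubst α σ) k (v' ++ [0]) ∧
      ∃ r, iterW (blockSubst α σ) k [y'] = y :: r := by
  induction n generalizing v x y with
  | zero =>
    have := h.length_le
    simp [iterW_zero] at this
  | succ n ih =>
    rw [iterW_succ'] at h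
    obtain ⟨v₁, x₁, y₁, h1, h2, r, hr⟩ := exists_desubst hx h
    by_cases hx₁ : x₁ = 0
    · subst hx₁
      exact ⟨n, 1, v₁, y₁, le_rfl, h1, h2, r, hr⟩
    · obtain ⟨n', k, v', y', hk, h3, h4, r', hr'⟩ := ih hx₁ h1
      refine ⟨n', k + 1, v', y', by omega, h3, by rw [iterW_succ', ← h4, h2], ?_⟩
      rw [iterW_succ', hr', show y₁ :: r' = [y₁] ++ r' from rfl, substW_append, hr]
      exact ⟨_, rfl⟩

theorem not_zero_zero_infix_substW {w : List ℕ} (hσ : ∀ x, σ x ≠ 0) (h : ∀ x ∈ w, α x ≤ 1) :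
    ¬ [0, 0] <:+: substW (blockSubst α σ) w := by
  induction w with
  | nil => simp [substW]
  | cons x w ih =>
    have ih := ih fun y hy => h y (by simp [hy])
    have hσx := (hσ x).symm
    rw [substW_blockSubst_cons]
    have := h x (by simp)
    interval_cases hx : α x
    · simpa [List.infix_cons_iff, List.cons_prefix_cons, hσx] using ih
    · simpa [List.infix_cons_iff, List.cons_prefix_cons, hσx] using ih

end BlockSubst

section ParrySucc

variable {m p : ℕ}

theorem parrySucc_ne_zero (hm : 1 ≤ m) (ℓ : ℕ) : parrySucc m p ℓ ≠ 0 := by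
  unfold parrySucc
  split <;> omega

theorem iterate_parrySucc_of_lt {i x : ℕ} (h : x + i < m + p) :
    (parrySucc m p)^[i] x = x + i := by
  induction i with
  | zero => rfl
  | succ i ih =>
    rw [Function.iterate_succ_apply', ih (by omega), parrySucc, if_neg (by omega)]
    omega

theorem iterate_parrySucc_period {ℓ : ℕ} (h1 : m ≤ ℓ) (h2 : ℓ < m + p) :
    (parrySucc m p)^[p] ℓ = ℓ := by
  have h3 (f : ℕ → ℕ) : f^[p] ℓ = f^[(ℓ - m) + ((m + p - 1 - ℓ) + 1)] ℓ := by
    congr 2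
    omega
  rw [h3, Function.iterate_add_apply, Function.iterate_succ_apply',
    iterate_parrySucc_of_lt (i := m + p - 1 - ℓ) (by omega),
    show parrySucc m p (ℓ + (m + p - 1 - ℓ)) = m by
      rw [parrySucc, if_pos (by omega)], iterate_parrySucc_of_lt (by omega)]
  omega

theorem iterate_parrySucc_zero {ℓ : ℕ} (h1 : m ≤ ℓ) (h2 : ℓ < m + p) (j : ℕ) :
    (parrySucc m p)^[ℓ + j * p] 0 = ℓ := by
  induction j with
  | zero => simpa using iterate_parrySucc_of_lt (m := m) (p := p) (i := ℓ) (x := 0) (by omega)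
  | succ j ih =>
    rw [show ℓ + (j + 1) * p = p + (ℓ + j * p) by ring, Function.iterate_add_apply, ih,
      iterate_parrySucc_period h1 h2]

theorem exists_of_iterate_parrySucc_zero (hp : 1 ≤ p) (k : ℕ) :
    (parrySucc m p)^[k] 0 < m + p ∧ ∃ j, k = (parrySucc m p)^[k] 0 + j * p ∧
      ((parrySucc m p)^[k] 0 < m → j = 0) := by
  induction k with
  | zero =>
    exact ⟨by simp; omega, 0, by simp⟩
  | succ k ih =>
    obtain ⟨h1, j, h2, h3⟩ := ih
    rw [Function.iterate_succ_apply']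
    set x := (parrySucc m p)^[k] 0
    unfold parrySucc
    split_ifs with hx
    · refine ⟨by omega, j + 1, ?_, by omega⟩
      rw [add_mul]
      omega
    · exact ⟨by omega, j, by omega, fun h => h3 (by omega)⟩

end ParrySucc

theorem stmt8
    (m p : ℕ) (hm : 1 ≤ m) (hp : 1 ≤ p) (α : ℕ → ℕ) (hα0 : 1 ≤ α 0)
    (hαle : ∀ ℓ, ℓ < m + p → α ℓ ≤ α 0)
    (hαex : ∃ ℓ, m ≤ ℓ ∧ ℓ ≤ m + p - 1 ∧ 1 ≤ α ℓ)
    (φ : ℕ → List ℕ)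
    (hφ : ∀ ℓ, ℓ + 1 < m + p → φ ℓ = List.replicate (α ℓ) 0 ++ [ℓ + 1])
    (hφlast : φ (m + p - 1) = List.replicate (α (m + p - 1)) 0 ++ [m])
    (u : ℕ → ℕ) (hu : ∀ i, u i < m + p)
    (hufix : ∀ k : ℕ, iterW φ k [0] = pref u (iterW φ k [0]).length)
    (h' : ℕ) (hh' : h' = sInf {ℓ : ℕ | m ≤ ℓ ∧ ℓ ≤ m + p - 1 ∧ 1 ≤ α ℓ})
    (t : List ℕ) (ht0 : t.count 0 = 0) (hfac : IsFactor u ([0] ++ t ++ [0])) :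
    (t = [] → [0, 0] = pref u 2) ∧
    (∀ hne : t ≠ [], (t.getLast hne < m ∨ h' < t.getLast hne) →
      ([0] ++ t ++ [0]) <:+ (iterW φ (t.getLast hne) [0] ++ [0]) ∧
      IsFactor u (iterW φ (t.getLast hne) [0] ++ [0])) ∧
    (∀ hne : t ≠ [], m ≤ t.getLast hne → t.getLast hne ≤ h' →
      (([0] ++ t ++ [0]) <:+ (iterW φ (t.getLast hne) [0] ++ [0]) ∧
        IsFactor u (iterW φ (t.getLast hne) [0] ++ [0])) ∨
      (([0] ++ t ++ [0]) <:+ (iterW φ (t.getLast hne + p) [0] ++ [0]) ∧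
        IsFactor u (iterW φ (t.getLast hne + p) [0] ++ [0]))) := by
  set ψ := blockSubst α (parrySucc m p) with hψ
  have hφψ : ∀ ℓ, ℓ < m + p → φ ℓ = ψ ℓ := by
    intro ℓ hℓ
    by_cases h : ℓ = m + p - 1
    · rw [h, hφlast, hψ, blockSubst, parrySucc, if_pos rfl]
    · rw [hφ ℓ (by omega), hψ, blockSubst, parrySucc, if_neg h]
  have hlt : ∀ k, ∀ x ∈ iterW φ k [0], x < m + p := by
    intro k x hx
    rw [hufix k] at hx
    obtain ⟨i, -, rfl⟩ := List.mem_map.1 hx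
    exact hu i
  have hiter : ∀ k, iterW φ k [0] = iterW ψ k [0] := by
    intro k
    induction k with
    | zero => rfl
    | succ k ih =>
      rw [iterW_succ', iterW_succ', ← ih]
      exact List.flatMap_congr fun x hx => hφψ x (hlt k x hx)
  simp only [hiter] at hlt hufix ⊢
  have hfactor : ∀ {v w : List ℕ} {k : ℕ}, v ++ w <+: iterW ψ k [0] → IsFactor u w := by
    intro v w k h
    rw [hufix k] at h
    exact isFactor_of_append_prefix_pref h
  obtain ⟨hh1, hh2, hh3⟩ : m ≤ h' ∧ h' ≤ m + p - 1 ∧ 1 ≤ α h' := by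
    rw [hh']
    exact Nat.sInf_mem hαex
  obtain ⟨n, v, hv⟩ : ∃ n v, v ++ ([0] ++ t ++ [0]) <+: iterW ψ n [0] := by
    obtain ⟨i, hi⟩ := hfac
    set l := ([0] ++ t ++ [0]).length with hl
    refine ⟨i + l, pref u i, ?_⟩
    have hlen := lt_length_iterW (σ := parrySucc m p) hα0 (i + l)
    obtain ⟨c, hc⟩ := Nat.exists_eq_add_of_le hlen.le
    rw [hufix (i + l), hc, pref_add, pref_add, ← hi]
    exact List.prefix_append _ _
  have ht : 0 ∉ t := List.count_eq_zero.1 ht0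
  have hfactor_of_head : ∀ k, h' ≤ k → IsFactor u (iterW ψ k [0] ++ [0]) := by
    intro k hk
    have hσ0 : parrySucc m p 0 = 1 := by
      rw [parrySucc, if_neg (by omega)]
    obtain ⟨r, hr⟩ := exists_iterW_singleton_eq_zero_cons (σ := parrySucc m p) hα0
      (i := h' - 1) (k := k) (x := 1) (by omega) (by
        rwa [iterate_parrySucc_of_lt (by omega), Nat.add_sub_cancel' (by omega)])
    obtain ⟨a, ha⟩ := Nat.exists_eq_add_of_le' hα0
    have h1 : iterW ψ (k + 1) [0] =
        iterW ψ k (List.replicate a 0) ++ (iterW ψ k [0] ++ [0]) ++ r := by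
      rw [iterW_succ, substW_blockSubst_cons, hσ0, ha, List.replicate_succ',
        show substW (blockSubst α (parrySucc m p)) [] = [] from rfl, iterW_append, iterW_append,
        hr]
      simp
    exact hfactor (k := k + 1) (h1 ▸ List.prefix_append _ _)
  refine ⟨?_, ?_⟩
  · rintro rfl
    have h2 : 2 ≤ α 0 := by
      by_contra! hcon
      cases n with
      | zero =>
        have := hv.length_le
        simp [iterW_zero] at this
      | succ n =>
        rw [iterW_succ'] at hv
        refine not_zero_zero_infix_substW (parrySucc_ne_zero hm) (fun x hx => ?_)
          (List.IsInfix.trans ⟨v, [], by simp⟩ hv.isInfix)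
        have := hαle x (hlt n x hx)
        omega
    obtain ⟨a, ha⟩ := Nat.exists_eq_add_of_le' h2
    have h1 := hufix 1
    have h3 : iterW ψ 1 [0] = [0, 0] ++ (List.replicate a 0 ++ [parrySucc m p 0]) := by
      rw [iterW_succ, iterW_zero, substW_blockSubst_cons, ha]
      rfl
    rw [h3, List.length_append, pref_add] at h1
    exact (List.append_inj h1 (by simp [length_pref])).1
  · rcases List.eq_nil_or_concat t with rfl | ⟨t', x, rfl⟩
    · simp
    simp only [List.concat_eq_append, List.getLast_append_singleton, ne_eq] at *
    have hx : x ≠ 0 := fun h => ht (by simp [h])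
    obtain ⟨n', k, v', y', hk, h1, h2, r, hr⟩ :=
      exists_ancestor (v := v ++ [0] ++ t') (y := 0) hx (by simpa using hv)
    have hzero : ∀ k, 0 ∈ iterW ψ k [0] := fun k => by
      obtain ⟨w, hw⟩ := exists_iterW_eq_zero_cons_of_cons (σ := parrySucc m p) hα0 k []
      exact hw ▸ List.mem_cons_self
    have hsuff : (0 :: (t' ++ [x])) <:+ iterW ψ k [0] := by
      refine zero_cons_suffix_of_append (W := iterW ψ k v') ht ?_ (hzero k)
      rw [← iterW_append, ← h2]
      exact ⟨v, by simp⟩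
    have hxk : (parrySucc m p)^[k] 0 = x := by
      obtain ⟨W, hW⟩ := exists_iterW_singleton_eq_append (α := α) (σ := parrySucc m p) k 0 0
      obtain ⟨s, hs⟩ := hsuff
      rw [add_zero, iterW_zero, ← hψ, ← hs] at hW
      rw [← List.cons_append, ← List.append_assoc] at hW
      exact (List.append_singleton_inj.1 hW).2.symm
    have hfac_k : IsFactor u (iterW ψ k [0] ++ [0]) := by
      have h3 : iterW ψ k (v' ++ [0, y']) <+: iterW ψ (k + n') [0] := by
        obtain ⟨c, hc⟩ := h1
        rw [iterW_add, ← hc, iterW_append ψ k _ c]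
        exact List.prefix_append _ _
      refine hfactor (v := iterW ψ k v') (List.IsPrefix.trans ⟨r, ?_⟩ h3)
      rw [show v' ++ [0, y'] = v' ++ ([0] ++ [y']) from rfl, iterW_append, iterW_append, hr]
      simp
    have hadd : ∀ {k}, (0 :: (t' ++ [x])) <:+ iterW ψ k [0] →
        [0] ++ (t' ++ [x]) ++ [0] <:+ iterW ψ k [0] ++ [0] := by
      rintro k ⟨s, hs⟩
      exact ⟨s, by rw [← hs]; simp⟩
    have htransfer : ∀ {a a' b c : ℕ}, k = a + b → (parrySucc m p)^[a] 0 = c →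
        (parrySucc m p)^[a'] 0 = c → 0 ∈ iterW ψ b [c] →
        (0 :: (t' ++ [x])) <:+ iterW ψ (a' + b) [0] := by
      intro a a' b c hkab ha ha' hc
      obtain ⟨W, hW⟩ := exists_iterW_singleton_eq_append (α := α) (σ := parrySucc m p) a b 0
      obtain ⟨W', hW'⟩ := exists_iterW_singleton_eq_append (α := α) (σ := parrySucc m p) a' b 0
      rw [ha] at hW
      rw [ha'] at hW'
      rw [hkab, hψ, hW] at hsuff
      rw [hψ, hW']
      exact (zero_cons_suffix_of_append ht hsuff hc).trans (List.suffix_append _ _)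
    obtain ⟨hxlt, j, hj, hj0⟩ := exists_of_iterate_parrySucc_zero (m := m) hp k
    rw [hxk] at hxlt hj hj0
    refine ⟨fun _ hcase => ?_, fun _ hmx hxh => ?_⟩
    · rcases hcase with hxm | hxh
      · obtain rfl : k = x := by simpa [hj0 hxm] using hj
        exact ⟨hadd hsuff, hfac_k⟩
      · refine ⟨hadd ?_, hfactor_of_head x hxh.le⟩
        have := htransfer (a := h' + j * p) (a' := h' + 0 * p) (b := x - h') (by omega)
          (iterate_parrySucc_zero hh1 (by omega) j) (iterate_parrySucc_zero hh1 (by omega) 0) (by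
            obtain ⟨w, hw⟩ := exists_iterW_singleton_eq_zero_cons (σ := parrySucc m p) hα0
              (i := 0) (k := x - h') (x := h') (by omega) hh3
            exact hw ▸ List.mem_cons_self)
        rwa [zero_mul, add_zero, Nat.add_sub_cancel' hxh.le] at this
    · cases j with
      | zero =>
        obtain rfl : k = x := by simpa using hj
        exact Or.inl ⟨hadd hsuff, hfac_k⟩
      | succ j =>
        refine Or.inr ⟨hadd ?_, hfactor_of_head (x + p) (by omega)⟩
        have := htransfer (a := x + j * p) (a' := x + 0 * p) (b := p) (by rw [hj]; ring)
          (iterate_parrySucc_zero hmx hxlt j) (iterate_parrySucc_zero hmx hxlt 0) (by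
            obtain ⟨i, rfl⟩ := Nat.exists_eq_add_of_le hxh
            have hmem : 0 ∈ iterW ψ (i + 1) [x] := by
              obtain ⟨W, hW⟩ :=
                exists_iterW_singleton_eq_append (α := α) (σ := parrySucc m p) i 1 x
              obtain ⟨w, hw⟩ := exists_iterW_singleton_eq_zero_cons (σ := parrySucc m p) hα0
                (i := 0) (k := 1) (x := x + i) (by omega) hh3
              rw [iterate_parrySucc_of_lt (by omega), hw] at hW
              rw [hψ, hW]
              simp
            obtain ⟨A, B, hAB⟩ := List.append_of_mem hmem
            obtain ⟨w, hw⟩ := exists_iterW_eq_zero_cons_of_cons (σ := parrySucc m p) hα0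
              (p - (i + 1)) B
            rw [show p = (p - (i + 1)) + (i + 1) by omega, iterW_add, hAB, iterW_append, hw]
            simp)
        rwa [zero_mul, add_zero] at this
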